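/- If V₁, V₂ ∈ 𝔛* satisfy ρ_{V₁} = 0 and ρ_{V₂} = 0, then ρ_{[V₁,V₂]} = 0. Hence the set of pseudo arc-length preserving 𝒫-local vector fields {V ∈ 𝔛* : ρ_V = 0} is a Lie subalgebra of (𝔛*, [·,·]). -/

import Mathlib

noncomputable section
open MvPolynomial

/-- The differential algebra `𝒫`: polynomials in `k₁⁽ᵐ⁾ = X (0, m)` and `k₂⁽ᵐ⁾ = X (1, m)`. -/
abbrev PP : Type := MvPolynomial (Fin 2 × ℕ) ℝ

/-- The derivation `f ↦ f′` with `D (kᵢ⁽ᵐ⁾) = kᵢ⁽ᵐ⁺¹⁾`. -/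
def Dx : Derivation ℝ PP PP :=
  MvPolynomial.mkDerivation ℝ (fun im : Fin 2 × ℕ => MvPolynomial.X (im.1, im.2 + 1))

def k1 : PP := MvPolynomial.X (0, 0)
def k2 : PP := MvPolynomial.X (1, 0)

/-- A `𝒫`-local vector field: a quadruple `(f, h, g, l) ∈ 𝒫⁴`. -/
structure LVF where
  f : PP
  h : PP
  g : PP
  l : PP

namespace LVF

instance : Zero LVF := ⟨⟨0, 0, 0, 0⟩⟩
instance : Neg LVF := ⟨fun U => ⟨-U.f, -U.h, -U.g, -U.l⟩⟩
instance : Add LVF := ⟨fun U W => ⟨U.f + W.f, U.h + W.h, U.g + W.g, U.l + W.l⟩⟩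
instance : Sub LVF := ⟨fun U W => ⟨U.f - W.f, U.h - W.h, U.g - W.g, U.l - W.l⟩⟩

def phi (a ε₁ : ℝ) (V : LVF) : PP := C a * V.f + Dx V.h - C ε₁ * k1 * V.g

def psi (ε₂ : ℝ) (V : LVF) : PP := Dx V.l + C ε₂ * k2 * V.g

def rho (a ε₁ : ℝ) (V : LVF) : PP :=
  - C a * Dx V.f + C (2 * a) * k1 * V.h - C a * k2 * V.l
    - Dx (phi a ε₁ V) + C ε₁ * k1 * Dx V.g

/-- Membership in `𝔛*`: `g_V′ = −ε₁·a·h_V`. -/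
def isStar (a ε₁ : ℝ) (V : LVF) : Prop := Dx V.g = - C (ε₁ * a) * V.h

def alpha (a ε₁ : ℝ) (V : LVF) : PP :=
  C (1 / a) * (Dx (phi a ε₁ V) + C (1 / 2) * rho a ε₁ V)

def beta (a ε₁ ε₂ G : ℝ) (V : LVF) : PP :=
  C (1 / a) * (Dx (alpha a ε₁ V) + k1 * phi a ε₁ V - k2 * psi ε₂ V - C G * V.g)

def delta (a ε₁ ε₂ : ℝ) (V : LVF) : PP :=
  C (1 / a) * Dx (Dx (psi ε₂ V)) + k1 * psi ε₂ V + C (ε₁ * ε₂) * k2 * phi a ε₁ V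

/-- The value `V̂(k₁)`. -/
def vk1 (a ε₁ ε₂ G : ℝ) (V : LVF) : PP :=
  C (1 / a ^ 2) * Dx (Dx (Dx (phi a ε₁ V)))
    + C (1 / a) * (Dx (k1 * phi a ε₁ V) + k1 * Dx (phi a ε₁ V))
    - C (1 / a) * (Dx (k2 * psi ε₂ V) + k2 * Dx (psi ε₂ V))
    + C (1 / a) * (C (1 / (2 * a)) * Dx (Dx (rho a ε₁ V)) + k1 * rho a ε₁ V
        - C (2 * G) * Dx V.g)

/-- The value `V̂(k₂)`. -/
def vk2 (a ε₁ ε₂ G : ℝ) (V : LVF) : PP :=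
  C (ε₁ * ε₂ / a ^ 2) * Dx (Dx (Dx (psi ε₂ V)))
    + C (ε₁ * ε₂ / a) * (Dx (k1 * psi ε₂ V) + k1 * Dx (psi ε₂ V))
    + C (1 / a) * (Dx (k2 * phi a ε₁ V) + k2 * Dx (phi a ε₁ V))
    + C (1 / a) * (k2 * rho a ε₁ V) - C (ε₂ * G) * V.l

/-- Values of `V̂` on the generators, defined by the recursion
`V̂(kᵢ⁽ᵐ⁺¹⁾) = (V̂(kᵢ⁽ᵐ⁾))′ + (1/(2a))·ρ_V·kᵢ⁽ᵐ⁺¹⁾`. -/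
def vhatFun (a ε₁ ε₂ G : ℝ) (V : LVF) : Fin 2 × ℕ → PP := fun im =>
  Nat.rec (motive := fun _ => PP)
    (if im.1 = 0 then vk1 a ε₁ ε₂ G V else vk2 a ε₁ ε₂ G V)
    (fun m prev => Dx prev + C (1 / (2 * a)) * rho a ε₁ V * MvPolynomial.X (im.1, m + 1))
    im.2

/-- The derivation `V̂` attached to `V ∈ 𝔛*`. -/
def vhat (a ε₁ ε₂ G : ℝ) (V : LVF) : Derivation ℝ PP PP :=
  MvPolynomial.mkDerivation ℝ (vhatFun a ε₁ ε₂ G V)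

/-- The operator `D_V U`. -/
def DV (a ε₁ ε₂ G : ℝ) (V U : LVF) : LVF where
  f := vhat a ε₁ ε₂ G V U.f - alpha a ε₁ V * U.f - beta a ε₁ ε₂ G V * U.h
        + C (ε₁ * ε₂ / a) * delta a ε₁ ε₂ V * U.l
  h := vhat a ε₁ ε₂ G V U.h + phi a ε₁ V * U.f - C ε₁ * beta a ε₁ ε₂ G V * U.g
        - C (ε₁ * ε₂ / a) * Dx (psi ε₂ V) * U.l
  g := vhat a ε₁ ε₂ G V U.g + C ε₁ * phi a ε₁ V * U.h + alpha a ε₁ V * U.g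
        + C ε₂ * psi ε₂ V * U.l
  l := vhat a ε₁ ε₂ G V U.l + psi ε₂ V * U.f + C (1 / a) * Dx (psi ε₂ V) * U.h
        + C (ε₁ / a) * delta a ε₁ ε₂ V * U.g

/-- The bracket `[V₁, V₂] = D_{V₁}V₂ − D_{V₂}V₁`. -/
def bracket (a ε₁ ε₂ G : ℝ) (V₁ V₂ : LVF) : LVF :=
  DV a ε₁ ε₂ G V₁ V₂ - DV a ε₁ ε₂ G V₂ V₁

end LVF

namespace LVF

theorem Dx_C (r : ℝ) : Dx (C r) = 0 := by
  rw [← MvPolynomial.algebraMap_eq]; exact Dx.map_algebraMap r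

theorem Dx_mul (p q : PP) : Dx (p * q) = p * Dx q + q * Dx p := by
  simp [Derivation.leibniz]

theorem vhat_mul (a ε₁ ε₂ G : ℝ) (V : LVF) (p q : PP) :
    vhat a ε₁ ε₂ G V (p * q) = p * vhat a ε₁ ε₂ G V q + q * vhat a ε₁ ε₂ G V p := by
  simp [Derivation.leibniz]

theorem vhat_C (a ε₁ ε₂ G : ℝ) (V : LVF) (r : ℝ) : vhat a ε₁ ε₂ G V (C r) = 0 := by
  rw [← MvPolynomial.algebraMap_eq]; exact (vhat a ε₁ ε₂ G V).map_algebraMap r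

theorem vhat_k1 (a ε₁ ε₂ G : ℝ) (V : LVF) :
    vhat a ε₁ ε₂ G V k1 = vk1 a ε₁ ε₂ G V := by
  simp [vhat, k1, mkDerivation_X, vhatFun]

theorem vhat_k2 (a ε₁ ε₂ G : ℝ) (V : LVF) :
    vhat a ε₁ ε₂ G V k2 = vk2 a ε₁ ε₂ G V := by
  simp [vhat, k2, mkDerivation_X, vhatFun]

/-- When `ρ_V = 0`, the derivation `V̂` commutes with `′`. -/
theorem vhat_Dx {a ε₁ ε₂ G : ℝ} {V : LVF} (hρ : rho a ε₁ V = 0) (p : PP) :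
    vhat a ε₁ ε₂ G V (Dx p) = Dx (vhat a ε₁ ε₂ G V p) := by
  have key : ⁅vhat a ε₁ ε₂ G V, Dx⁆ = 0 := by
    apply MvPolynomial.derivation_ext
    intro im
    simp [Derivation.commutator_apply, vhat, Dx, mkDerivation_X, vhatFun, hρ]
  have := congrArg (fun d : Derivation ℝ PP PP => d p) key
  simpa [Derivation.commutator_apply, sub_eq_zero] using this

theorem rho_of_isStar {a ε₁ : ℝ} (hε₁ : ε₁ = 1 ∨ ε₁ = -1) {V : LVF} (h : isStar a ε₁ V) :
    rho a ε₁ V = - C (2 * a) * Dx V.f - Dx (Dx V.h) + C ε₁ * Dx k1 * V.g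
      - C a * k2 * V.l := by
  have h' : Dx V.g = - C (ε₁ * a) * V.h := h
  apply MvPolynomial.funext
  intro x
  simp only [rho, phi, map_add, map_sub, map_neg, map_mul, Dx_mul, Dx_C, h', eval_C]
  rcases hε₁ with rfl | rfl <;> simp <;> ring

theorem Dx_l (ε₂ : ℝ) (V : LVF) : Dx V.l = psi ε₂ V - C ε₂ * k2 * V.g := by
  simp [psi]

theorem f_eq {a : ℝ} (ha : a ≠ 0) (ε₁ : ℝ) (V : LVF) :
    V.f = C (1 / a) * (phi a ε₁ V - Dx V.h + C ε₁ * k1 * V.g) := by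
  apply MvPolynomial.funext
  intro x
  simp only [phi, map_add, map_sub, map_mul, eval_C]
  field_simp
  ring

theorem Dx_Dx_h {a ε₁ : ℝ} (ha : a ≠ 0) (hε₁ : ε₁ = 1 ∨ ε₁ = -1) {V : LVF}
    (h : isStar a ε₁ V) (hρ : rho a ε₁ V = 0) :
    Dx (Dx V.h) = C 2 * Dx (phi a ε₁ V) + C ε₁ * Dx k1 * V.g - C (2 * a) * k1 * V.h
      + C a * k2 * V.l := by
  rw [rho_of_isStar hε₁ h, f_eq ha ε₁] at hρ
  have h' : Dx V.g = - C (ε₁ * a) * V.h := h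
  apply MvPolynomial.funext
  intro x
  have e := congrArg (eval x) hρ
  simp only [map_add, map_sub, map_neg, map_mul, Dx_mul, Dx_C, h', eval_C, map_zero] at e ⊢
  rcases hε₁ with rfl | rfl <;> field_simp at e ⊢ <;> linear_combination e

theorem isStar_bracket {a ε₁ ε₂ G : ℝ} (ha : a ≠ 0) (hε₁ : ε₁ = 1 ∨ ε₁ = -1)
    (hε₂ : ε₂ = 1 ∨ ε₂ = -1) {V₁ V₂ : LVF} (h₁ : isStar a ε₁ V₁) (h₂ : isStar a ε₁ V₂)
    (hρ₁ : rho a ε₁ V₁ = 0) (hρ₂ : rho a ε₁ V₂ = 0) :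
    isStar a ε₁ (bracket a ε₁ ε₂ G V₁ V₂) := by
  have g₁ : Dx V₁.g = - C (ε₁ * a) * V₁.h := h₁
  have g₂ : Dx V₂.g = - C (ε₁ * a) * V₂.h := h₂
  change Dx ((DV a ε₁ ε₂ G V₁ V₂).g - (DV a ε₁ ε₂ G V₂ V₁).g) =
    - C (ε₁ * a) * ((DV a ε₁ ε₂ G V₁ V₂).h - (DV a ε₁ ε₂ G V₂ V₁).h)
  apply MvPolynomial.funext
  intro x
  simp only [DV, beta, alpha, hρ₁, hρ₂, f_eq ha ε₁ V₁, f_eq ha ε₁ V₂, ← vhat_Dx hρ₁,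
    ← vhat_Dx hρ₂, g₁, g₂, Dx_l ε₂, map_add, map_sub, map_neg, map_mul, map_zero, Dx_mul, Dx_C,
    vhat_mul, vhat_C, eval_C]
  rcases hε₁ with rfl | rfl <;> rcases hε₂ with rfl | rfl <;> field_simp <;> ring

set_option maxHeartbeats 4000000 in
theorem rho_bracket {a ε₁ ε₂ G : ℝ} (ha : a ≠ 0) (hε₁ : ε₁ = 1 ∨ ε₁ = -1)
    (hε₂ : ε₂ = 1 ∨ ε₂ = -1) {V₁ V₂ : LVF} (h₁ : isStar a ε₁ V₁) (h₂ : isStar a ε₁ V₂)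
    (hρ₁ : rho a ε₁ V₁ = 0) (hρ₂ : rho a ε₁ V₂ = 0) :
    rho a ε₁ (bracket a ε₁ ε₂ G V₁ V₂) = 0 := by
  rw [rho_of_isStar hε₁ (isStar_bracket ha hε₁ hε₂ h₁ h₂ hρ₁ hρ₂)]
  have g₁ : Dx V₁.g = - C (ε₁ * a) * V₁.h := h₁
  have g₂ : Dx V₂.g = - C (ε₁ * a) * V₂.h := h₂
  change - C (2 * a) * Dx ((DV a ε₁ ε₂ G V₁ V₂).f - (DV a ε₁ ε₂ G V₂ V₁).f)
    - Dx (Dx ((DV a ε₁ ε₂ G V₁ V₂).h - (DV a ε₁ ε₂ G V₂ V₁).h))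
    + C ε₁ * Dx k1 * ((DV a ε₁ ε₂ G V₁ V₂).g - (DV a ε₁ ε₂ G V₂ V₁).g)
    - C a * k2 * ((DV a ε₁ ε₂ G V₁ V₂).l - (DV a ε₁ ε₂ G V₂ V₁).l) = 0
  apply MvPolynomial.funext
  intro x
  simp only [DV, delta, beta, alpha, hρ₁, hρ₂, f_eq ha ε₁ V₁, f_eq ha ε₁ V₂, ← vhat_Dx hρ₁,
    ← vhat_Dx hρ₂, g₁, g₂, Dx_l ε₂, Dx_Dx_h ha hε₁ h₁ hρ₁, Dx_Dx_h ha hε₁ h₂ hρ₂,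
    map_add, map_sub, map_neg, map_mul, map_zero, Dx_mul, Dx_C,
    vhat_mul, vhat_C]
  simp only [vhat_Dx hρ₁, vhat_Dx hρ₂, vhat_k1, vhat_k2, vk1, vk2, hρ₁, hρ₂, g₁, g₂,
    map_add, map_sub, map_neg, map_mul, map_zero, Dx_mul, Dx_C, eval_C]
  rcases hε₁ with rfl | rfl <;> rcases hε₂ with rfl | rfl <;> field_simp <;> ring

end LVF

/-- The pseudo arc-length preserving `𝒫`-local vector fields form a Lie
subalgebra: the bracket of two fields with `ρ = 0` again lies in `𝔛*` and has `ρ = 0`. -/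
theorem stmt13 (a ε₁ ε₂ G : ℝ) (ha : a ≠ 0) (hε₁ : ε₁ = 1 ∨ ε₁ = -1)
    (hε₂ : ε₂ = 1 ∨ ε₂ = -1) (V₁ V₂ : LVF)
    (h₁ : LVF.isStar a ε₁ V₁) (h₂ : LVF.isStar a ε₁ V₂)
    (hρ₁ : LVF.rho a ε₁ V₁ = 0) (hρ₂ : LVF.rho a ε₁ V₂ = 0) :
    LVF.isStar a ε₁ (LVF.bracket a ε₁ ε₂ G V₁ V₂) ∧
      LVF.rho a ε₁ (LVF.bracket a ε₁ ε₂ G V₁ V₂) = 0 := by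
  exact ⟨LVF.isStar_bracket ha hε₁ hε₂ h₁ h₂ hρ₁ hρ₂,
    LVF.rho_bracket ha hε₁ hε₂ h₁ h₂ hρ₁ hρ₂⟩
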